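/- Let n ≥ 2, r₁, r₂ > 0, and c₁, c₂ ∈ ℝⁿ with time coordinates (c₁)₀ = (c₂)₀ = 0. Then the Euclidean closed balls closedBall(c₁, r₁) and closedBall(c₂, r₂) are causally disjoint if and only if ‖c₁ − c₂‖ > √2 (r₁ + r₂). -/

import Mathlib

open Set Metric unitInterval

noncomputable section

/-- `n`-dimensional Minkowski space, modeled as `ℝⁿ` with the Euclidean norm. -/
abbrev Mink (n : ℕ) := EuclideanSpace ℝ (Fin n)

/-- The spatial part `x⃗ = (x 1, …, x (n-1)) ∈ ℝ^{n-1}` of `x ∈ ℝⁿ`. -/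
def spatial {n : ℕ} (x : Mink n) : Mink (n - 1) :=
  (WithLp.equiv 2 _).symm fun i : Fin (n - 1) => x ⟨i.1 + 1, by have := i.isLt; omega⟩

/-- A curve `γ` is future-directed causal if it is `C¹` and
`(γ₀)'(t) ≥ ‖(γ⃗)'(t)‖` for all `t ∈ [0,1]`. -/
def FDCausal {n : ℕ} [NeZero n] (γ : ℝ → Mink n) : Prop :=
  ContDiff ℝ 1 γ ∧
    ∀ t ∈ Set.Icc (0 : ℝ) 1,
      ‖deriv (fun s => spatial (γ s)) t‖ ≤ deriv (fun s => γ s 0) t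

/-- A curve `γ` is past-directed causal if it is `C¹` and
`-(γ₀)'(t) ≥ ‖(γ⃗)'(t)‖` for all `t ∈ [0,1]`. -/
def PDCausal {n : ℕ} [NeZero n] (γ : ℝ → Mink n) : Prop :=
  ContDiff ℝ 1 γ ∧
    ∀ t ∈ Set.Icc (0 : ℝ) 1,
      ‖deriv (fun s => spatial (γ s)) t‖ ≤ -(deriv (fun s => γ s 0) t)

/-- A causal curve is a future- or past-directed causal curve. -/
def IsCausalCurve {n : ℕ} [NeZero n] (γ : ℝ → Mink n) : Prop :=
  FDCausal γ ∨ PDCausal γ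

/-- `S` and `T` are causally disjoint if no causal curve starts in `S` and ends in `T`. -/
def CausallyDisjoint {n : ℕ} [NeZero n] (S T : Set (Mink n)) : Prop :=
  ¬ ∃ γ : ℝ → Mink n, IsCausalCurve γ ∧ γ 0 ∈ S ∧ γ 1 ∈ T

/-- The spatial part as a continuous linear map. -/
def spatialCLM (n : ℕ) : Mink n →L[ℝ] Mink (n - 1) :=
  LinearMap.toContinuousLinearMap
    { toFun := spatial
      map_add' := fun _ _ => rfl
      map_smul' := fun _ _ => rfl }

theorem spatial_add {n : ℕ} (x y : Mink n) : spatial (x + y) = spatial x + spatial y := rfl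

theorem spatial_sub {n : ℕ} (x y : Mink n) : spatial (x - y) = spatial x - spatial y := rfl

theorem spatial_smul {n : ℕ} (a : ℝ) (x : Mink n) : spatial (a • x) = a • spatial x := rfl

theorem norm_sq_eq_time_add_spatial {n : ℕ} [NeZero n] (x : Mink n) :
    ‖x‖ ^ 2 = x 0 ^ 2 + ‖spatial x‖ ^ 2 := by
  obtain ⟨m, rfl⟩ := Nat.exists_eq_succ_of_ne_zero (NeZero.ne n)
  rw [EuclideanSpace.real_norm_sq_eq, EuclideanSpace.real_norm_sq_eq, Fin.sum_univ_succ]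
  rfl

theorem norm_spatial_of_time_eq_zero {n : ℕ} [NeZero n] {x : Mink n} (hx : x 0 = 0) :
    ‖spatial x‖ = ‖x‖ := by
  have h := norm_sq_eq_time_add_spatial x
  rw [hx] at h
  exact (sq_eq_sq₀ (norm_nonneg _) (norm_nonneg _)).1 (by linarith)

/-- If `‖f'‖ ≤ g'` on `[a, b]`, then `f` moves at most as far as `g` does. -/
theorem norm_sub_le_sub_of_norm_deriv_le_deriv {E : Type*} [NormedAddCommGroup E]
    [NormedSpace ℝ E] {f : ℝ → E} {g : ℝ → ℝ} {a b : ℝ} (hab : a ≤ b)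
    (hf : Differentiable ℝ f) (hg : Differentiable ℝ g)
    (h : ∀ t ∈ Set.Icc a b, ‖deriv f t‖ ≤ deriv g t) :
    ‖f b - f a‖ ≤ g b - g a := by
  refine image_norm_le_of_norm_deriv_right_le_deriv_boundary
    (f := fun t => f t - f a) (f' := deriv f) (B := fun t => g t - g a) (B' := deriv g)
    (hf.continuous.sub continuous_const).continuousOn
    (fun t _ => ((hf t).hasDerivAt.sub_const (f a)).hasDerivWithinAt) (by simp)
    (fun t => (hg t).hasDerivAt.sub_const (g a))
    (fun t ht => h t (Set.Ico_subset_Icc_self ht)) (Set.right_mem_Icc.2 hab)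

theorem IsCausalCurve.norm_spatial_sub_le {n : ℕ} [NeZero n] {γ : ℝ → Mink n}
    (hγ : IsCausalCurve γ) : ‖spatial (γ 1 - γ 0)‖ ≤ |(γ 1 - γ 0) 0| := by
  have hs (h : ContDiff ℝ 1 γ) : Differentiable ℝ fun s => spatial (γ s) :=
    (spatialCLM n).differentiable.comp (h.differentiable one_ne_zero)
  have ht (h : ContDiff ℝ 1 γ) : Differentiable ℝ fun s => γ s 0 :=
    (EuclideanSpace.proj (𝕜 := ℝ) (0 : Fin n)).differentiable.comp
      (h.differentiable one_ne_zero)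
  rw [spatial_sub, PiLp.sub_apply]
  rcases hγ with ⟨hc, h⟩ | ⟨hc, h⟩
  · exact (norm_sub_le_sub_of_norm_deriv_le_deriv zero_le_one (hs hc) (ht hc) h).trans
      (le_abs_self _)
  · have := norm_sub_le_sub_of_norm_deriv_le_deriv zero_le_one (hs hc) (ht hc).fun_neg
      (fun t hmem => by rw [deriv.fun_neg]; exact h t hmem)
    exact (this.trans_eq (by ring)).trans (neg_le_abs (γ 1 0 - γ 0 0))

theorem isCausalCurve_line {n : ℕ} [NeZero n] (p : Mink n) {v : Mink n}
    (hv : ‖spatial v‖ ≤ v 0) : IsCausalCurve fun t : ℝ => p + t • v := by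
  refine Or.inl ⟨by fun_prop, fun t _ => ?_⟩
  have hd : HasDerivAt (fun t : ℝ => p + t • v) v t := by
    simpa using ((hasDerivAt_id t).smul_const v).const_add p
  have hs := ((spatialCLM n).hasFDerivAt.comp_hasDerivAt t hd).deriv
  have ht := ((EuclideanSpace.proj (𝕜 := ℝ) (0 : Fin n)).hasFDerivAt.comp_hasDerivAt t hd).deriv
  calc _ = ‖spatial v‖ := congrArg norm hs
    _ ≤ v 0 := hv
    _ = _ := ht.symm

/-- The distance between points at equal times is at most `√2` times any displacement that
brings them into causal relation. -/
theorem norm_le_sqrt_two_mul_norm_sub {n : ℕ} [NeZero n] {d v : Mink n} (hd : d 0 = 0)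
    (hv : ‖spatial v‖ ≤ |v 0|) : ‖d‖ ≤ Real.sqrt 2 * ‖d - v‖ := by
  have h1 : ‖d‖ ≤ |v 0| + ‖spatial (d - v)‖ := by
    rw [← norm_spatial_of_time_eq_zero hd]
    calc ‖spatial d‖ = ‖spatial v + spatial (d - v)‖ := by rw [← spatial_add, add_sub_cancel]
      _ ≤ ‖spatial v‖ + ‖spatial (d - v)‖ := norm_add_le _ _
      _ ≤ _ := by gcongr
  have h2 := norm_sq_eq_time_add_spatial (d - v)
  rw [PiLp.sub_apply, hd, zero_sub, neg_sq, ← sq_abs (v 0)] at h2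
  refine h1.trans (abs_le_of_sq_le_sq' ?_ (by positivity)).2
  rw [mul_pow, Real.sq_sqrt zero_le_two, h2]
  nlinarith [sq_nonneg (|v 0| - ‖spatial (d - v)‖)]

theorem exists_causal_vector_near {n : ℕ} [NeZero n] {d : Mink n} (hd : d 0 = 0) :
    ∃ v : Mink n, ‖spatial v‖ ≤ v 0 ∧ Real.sqrt 2 * ‖d - v‖ = ‖d‖ := by
  have he : spatial (EuclideanSpace.single (0 : Fin n) (1 : ℝ)) = 0 := by
    ext i
    simp [spatial, Fin.ext_iff]
  refine ⟨(1 / 2 : ℝ) • d + (‖d‖ / 2) • EuclideanSpace.single 0 1, ?_, ?_⟩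
  · rw [spatial_add, spatial_smul, spatial_smul, he, smul_zero, add_zero, norm_smul,
      norm_spatial_of_time_eq_zero hd]
    simp [hd]
    linarith
  · have h := norm_sq_eq_time_add_spatial
      (d - ((1 / 2 : ℝ) • d + (‖d‖ / 2) • EuclideanSpace.single 0 1))
    have hs : spatial (d - ((1 / 2 : ℝ) • d + (‖d‖ / 2) • EuclideanSpace.single 0 1)) =
        (1 / 2 : ℝ) • spatial d := by
      rw [spatial_sub, spatial_add, spatial_smul, spatial_smul, he]
      module
    have ht : (d - ((1 / 2 : ℝ) • d + (‖d‖ / 2) • EuclideanSpace.single 0 1) : Mink n) 0 =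
        -(‖d‖ / 2) := by simp [hd]
    rw [hs, ht, norm_smul, norm_spatial_of_time_eq_zero hd, Real.norm_of_nonneg (by norm_num)] at h
    refine (sq_eq_sq₀ (by positivity) (norm_nonneg _)).1 ?_
    rw [mul_pow, Real.sq_sqrt zero_le_two, h]
    ring

/-- Two balls centered in the time-zero hyperplane are causally disjoint iff the
distance between the centers exceeds `√2 (r₁ + r₂)`. -/
theorem causallyDisjoint_balls_time_zero_iff (n : ℕ) [NeZero n] (hn : 2 ≤ n)
    (r₁ r₂ : ℝ) (hr₁ : 0 < r₁) (hr₂ : 0 < r₂)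
    (c₁ c₂ : Mink n) (hc₁ : c₁ 0 = 0) (hc₂ : c₂ 0 = 0) :
    CausallyDisjoint (closedBall c₁ r₁) (closedBall c₂ r₂) ↔
      Real.sqrt 2 * (r₁ + r₂) < ‖c₁ - c₂‖ := by
  rw [CausallyDisjoint, ← not_le, not_iff_not]
  have hd : (c₂ - c₁) 0 = 0 := by simp [hc₁, hc₂]
  rw [norm_sub_rev]
  constructor
  · rintro ⟨γ, hγ, h0, h1⟩
    rw [mem_closedBall, dist_eq_norm] at h0 h1
    refine (norm_le_sqrt_two_mul_norm_sub hd hγ.norm_spatial_sub_le).trans ?_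
    gcongr
    calc ‖c₂ - c₁ - (γ 1 - γ 0)‖ = ‖(γ 0 - c₁) - (γ 1 - c₂)‖ := by congr 1; abel
      _ ≤ ‖γ 0 - c₁‖ + ‖γ 1 - c₂‖ := norm_sub_le _ _
      _ ≤ r₁ + r₂ := add_le_add h0 h1
  · intro h
    obtain ⟨v, hv, hw⟩ := exists_causal_vector_near hd
    have hR : 0 < r₁ + r₂ := add_pos hr₁ hr₂
    have hle : ‖c₂ - c₁ - v‖ ≤ r₁ + r₂ :=
      le_of_mul_le_mul_left (hw.trans_le h) (by positivity)
    have hscale {r : ℝ} (hr : 0 < r) : ‖(r / (r₁ + r₂)) • (c₂ - c₁ - v)‖ ≤ r := by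
      rw [norm_smul, Real.norm_of_nonneg (by positivity), div_mul_eq_mul_div, div_le_iff₀ hR]
      gcongr
    refine ⟨_, isCausalCurve_line (c₁ + (r₁ / (r₁ + r₂)) • (c₂ - c₁ - v)) hv, ?_, ?_⟩
    · rw [mem_closedBall, dist_eq_norm]
      simpa using hscale hr₁
    · have hfrac : r₂ / (r₁ + r₂) = 1 - r₁ / (r₁ + r₂) := by
        field_simp
        ring
      have hend : c₁ + (r₁ / (r₁ + r₂)) • (c₂ - c₁ - v) + (1 : ℝ) • v - c₂ =
          -((r₂ / (r₁ + r₂)) • (c₂ - c₁ - v)) := by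
        rw [hfrac]
        module
      rw [mem_closedBall, dist_eq_norm, hend, norm_neg]
      exact hscale hr₂
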